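/- arXiv:1106.2440 — 4 statements merged into one kernel-verified Lean document; each statement's English description precedes it below -/
import Mathlib

section
/- Let n ≥ 1, let d = (k_1,…,k_n) be a graphical degree sequence (there exists a graph on {1,…,n} with degree sequence d), and let f : ℝ → ℝ be a convex function with strict minimum at 0 (f(0) < f(x) for all x ≠ 0). Give player i the payoff Y_i(g) = −f(η_i(g) − k_i). Then a graph g on {1,…,n} is both pairwise stable and Pareto optimal with respect to Y_1,…,Y_n if and only if η_i(g) = k_i for all i. -/
open Finset

/-- The degree of vertex `i` in the simple graph `g`. -/
noncomputable def deg {n : ℕ} (g : SimpleGraph (Fin n)) (i : Fin n) : ℕ :=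
  Nat.card (g.neighborSet i)

/-- The graph obtained from `g` by deleting the link `ij`. -/
def delLink {n : ℕ} (g : SimpleGraph (Fin n)) (i j : Fin n) : SimpleGraph (Fin n) :=
  g.deleteEdges {s(i, j)}

/-- The graph obtained from `g` by adding the link `ij`. -/
def addLink {n : ℕ} (g : SimpleGraph (Fin n)) (i j : Fin n) : SimpleGraph (Fin n) :=
  g ⊔ SimpleGraph.fromEdgeSet {s(i, j)}

/-- Pairwise stability of a graph `g` with respect to payoffs `Y`. -/
def PairwiseStable {n : ℕ} (Y : Fin n → SimpleGraph (Fin n) → ℝ)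
    (g : SimpleGraph (Fin n)) : Prop :=
  (∀ i j, g.Adj i j → Y i (delLink g i j) ≤ Y i g ∧ Y j (delLink g i j) ≤ Y j g) ∧
  (∀ i j, i ≠ j → ¬ g.Adj i j → (Y i g < Y i (addLink g i j) → Y j (addLink g i j) < Y j g))

/-- Pareto optimality of a graph `g` with respect to payoffs `Y`: there is no graph
weakly better for everybody and strictly better for somebody. -/
def ParetoOptimal {n : ℕ} (Y : Fin n → SimpleGraph (Fin n) → ℝ)
    (g : SimpleGraph (Fin n)) : Prop :=
  ¬ ∃ g' : SimpleGraph (Fin n), (∀ i, Y i g ≤ Y i g') ∧ (∃ i, Y i g < Y i g')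

theorem stmt_2 (n : ℕ) (hn : 1 ≤ n) (k : Fin n → ℕ)
    (hgraphical : ∃ g₀ : SimpleGraph (Fin n), ∀ i, deg g₀ i = k i)
    (f : ℝ → ℝ) (hconv : ConvexOn ℝ Set.univ f)
    (hmin : ∀ x : ℝ, x ≠ 0 → f 0 < f x)
    (Y : Fin n → SimpleGraph (Fin n) → ℝ)
    (hY : ∀ i g, Y i g = - f ((deg g i : ℝ) - (k i : ℝ)))
    (g : SimpleGraph (Fin n)) :
    (PairwiseStable Y g ∧ ParetoOptimal Y g) ↔ (∀ i, deg g i = k i) := by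
  have hle : ∀ x, f 0 ≤ f x := fun x => by
    rcases eq_or_ne x 0 with rfl | hx
    exacts [le_rfl, (hmin x hx).le]
  constructor
  · rintro ⟨-, hP⟩
    by_contra! hne
    obtain ⟨i, hi⟩ := hne
    obtain ⟨g₀, hg₀⟩ := hgraphical
    have hY₀ : ∀ j, Y j g₀ = - f 0 := fun j => by rw [hY, hg₀, sub_self]
    refine hP ⟨g₀, fun j => ?_, i, ?_⟩
    · rw [hY₀, hY]
      exact neg_le_neg (hle _)
    · rw [hY₀, hY]
      exact neg_lt_neg (hmin _ (sub_ne_zero.mpr (Nat.cast_injective.ne hi)))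
  · intro h
    have hmax : ∀ i g', Y i g' ≤ Y i g := fun i g' => by
      rw [hY i g, hY i g', h, sub_self]
      exact neg_le_neg (hle _)
    exact ⟨⟨fun i j _ => ⟨hmax i _, hmax j _⟩, fun i j _ _ hlt => absurd hlt (hmax i _).not_gt⟩,
      fun ⟨g', _, i, hi⟩ => (hmax i g').not_gt hi⟩
end

section
/- Let n ≥ 2, let f : ℝ → ℝ be convex and nonnegative with f(0) ≤ f(x) for all x ∈ ℝ, and let k_1,…,k_n be integers with 1 ≤ k_i ≤ n−1. Suppose the parameters satisfy α − γ₀ − n·max(f(n−1), f(1−n)) − ((n−1)/2)·max(f(1) − f(0), f(−1) − f(0)) > 0. Then for every graph g on {1,…,n} and every firm i: (a) 2·q_i(g) − ((n−1)/(n+1))·(f(1) − f(0)) > 0; (b) 2·q_i(g) − ((n−1)/(n+1))·(f(−1) − f(0)) > 0; and consequently (c) q_i(g) ≥ 0. -/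
open Finset

theorem deg_le {n : ℕ} (g : SimpleGraph (Fin n)) (i : Fin n) : deg g i ≤ n :=
  (Finite.card_subtype_le (· ∈ g.neighborSet i)).trans_eq (Nat.card_fin n)

theorem stmt_5 (n : ℕ) (hn : 2 ≤ n) (α γ₀ : ℝ) (f : ℝ → ℝ)
    (hconv : ConvexOn ℝ Set.univ f) (hnonneg : ∀ x : ℝ, 0 ≤ f x)
    (hmin : ∀ x : ℝ, f 0 ≤ f x)
    (k : Fin n → ℤ) (hk : ∀ i, 1 ≤ k i ∧ k i ≤ (n : ℤ) - 1)
    (hparam : α - γ₀ - n * max (f ((n : ℝ) - 1)) (f (1 - (n : ℝ)))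
      - (((n : ℝ) - 1) / 2) * max (f 1 - f 0) (f (-1) - f 0) > 0)
    (q : SimpleGraph (Fin n) → Fin n → ℝ)
    (hq : ∀ g i, q g i = (α - γ₀ - n * f ((deg g i : ℝ) - (k i : ℝ))
      + ∑ j ∈ univ.erase i, f ((deg g j : ℝ) - (k j : ℝ))) / (n + 1)) :
    ∀ (g : SimpleGraph (Fin n)) (i : Fin n),
      (2 * q g i - (((n : ℝ) - 1) / ((n : ℝ) + 1)) * (f 1 - f 0) > 0) ∧
      (2 * q g i - (((n : ℝ) - 1) / ((n : ℝ) + 1)) * (f (-1) - f 0) > 0) ∧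
      0 ≤ q g i := by
  intro g i
  have hn1 : (0 : ℝ) < n + 1 := by positivity
  have hdeg : (deg g i : ℝ) ≤ n := by exact_mod_cast deg_le g i
  have hdeg0 : (0 : ℝ) ≤ deg g i := Nat.cast_nonneg _
  have hk1 : (1 : ℝ) ≤ k i := by exact_mod_cast (hk i).1
  have hk2 : (k i : ℝ) ≤ n - 1 := by exact_mod_cast (hk i).2
  have hcost : f ((deg g i : ℝ) - k i) ≤ max (f ((n : ℝ) - 1)) (f (1 - (n : ℝ))) := by
    rw [max_comm]
    exact hconv.le_max_of_mem_Icc (Set.mem_univ _) (Set.mem_univ _)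
      ⟨by linarith, by linarith⟩
  have hsum : 0 ≤ ∑ j ∈ univ.erase i, f ((deg g j : ℝ) - (k j : ℝ)) :=
    sum_nonneg fun j _ => hnonneg _
  have hncost := mul_le_mul_of_nonneg_left hcost (Nat.cast_nonneg (α := ℝ) n)
  have hn_sub : (0 : ℝ) ≤ n - 1 := by linarith
  have key : ∀ c ≤ max (f 1 - f 0) (f (-1) - f 0),
      2 * q g i - (((n : ℝ) - 1) / ((n : ℝ) + 1)) * c > 0 := by
    intro c hc
    have hc' := mul_le_mul_of_nonneg_left hc hn_sub
    have heq : 2 * q g i - (((n : ℝ) - 1) / ((n : ℝ) + 1)) * c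
        = (2 * (α - γ₀ - n * f ((deg g i : ℝ) - (k i : ℝ))
          + ∑ j ∈ univ.erase i, f ((deg g j : ℝ) - (k j : ℝ))) - (n - 1) * c) / (n + 1) := by
      rw [hq]
      ring
    rw [heq]
    exact div_pos (by linarith) hn1
  have hpos := key 0 (le_max_of_le_left (sub_nonneg.2 (hmin 1)))
  exact ⟨key _ (le_max_left _ _), key _ (le_max_right _ _), by linarith⟩
end

section
/- Let n ≥ 1, let f : ℝ → ℝ, let k_1,…,k_n be reals, and write Δ⁻ = f(−1) − f(0). Let g be a graph on {1,…,n} with η_i(g) = k_i for all i, and let ij be a link of g. Then: q_i(g − ij) = q_i(g) − (n/(n+1))·Δ⁻ + (1/(n+1))·Δ⁻; q_j(g − ij) = q_j(g) − (n/(n+1))·Δ⁻ + (1/(n+1))·Δ⁻; for every l ∉ {i,j}, q_l(g − ij) = q_l(g) + (2/(n+1))·Δ⁻; Q(g − ij) = Q(g) − (2/(n+1))·Δ⁻; P(g − ij) = P(g) + (2/(n+1))·Δ⁻; and c_i(g − ij) = c_i(g) + Δ⁻. -/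
open Finset

theorem deg_delLink_left {n : ℕ} {g : SimpleGraph (Fin n)} {i j : Fin n} (h : g.Adj i j) :
    (deg (delLink g i j) i : ℝ) = deg g i - 1 := by
  have hset : (delLink g i j).neighborSet i = g.neighborSet i \ {j} := by
    ext l
    simp only [delLink, SimpleGraph.mem_neighborSet, SimpleGraph.deleteEdges_adj,
      Set.mem_singleton_iff, Set.mem_sdiff, Sym2.eq_iff]
    grind
  have hcard := Set.ncard_sdiff_singleton_add_one (s := g.neighborSet i) h
  simp only [deg, hset, Nat.card_coe_set_eq]
  rw [← hcard]
  push_cast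
  ring

theorem delLink_comm {n : ℕ} (g : SimpleGraph (Fin n)) (i j : Fin n) :
    delLink g i j = delLink g j i := by
  rw [delLink, delLink, Sym2.eq_swap]

theorem deg_delLink_right {n : ℕ} {g : SimpleGraph (Fin n)} {i j : Fin n} (h : g.Adj i j) :
    (deg (delLink g i j) j : ℝ) = deg g j - 1 := by
  rw [delLink_comm, deg_delLink_left h.symm]

theorem deg_delLink_of_ne {n : ℕ} (g : SimpleGraph (Fin n)) {i j l : Fin n}
    (hi : l ≠ i) (hj : l ≠ j) : deg (delLink g i j) l = deg g l := by
  have hset : (delLink g i j).neighborSet l = g.neighborSet l := by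
    ext m
    simp only [delLink, SimpleGraph.mem_neighborSet, SimpleGraph.deleteEdges_adj,
      Set.mem_singleton_iff, Sym2.eq_iff]
    grind
  rw [deg, deg, hset]

theorem stmt_7 (n : ℕ) (hn : 1 ≤ n) (α γ₀ : ℝ) (f : ℝ → ℝ) (k : Fin n → ℝ)
    (q : SimpleGraph (Fin n) → Fin n → ℝ)
    (hq : ∀ g i, q g i = (α - γ₀ - n * f ((deg g i : ℝ) - k i)
      + ∑ j ∈ univ.erase i, f ((deg g j : ℝ) - k j)) / (n + 1))
    (Q : SimpleGraph (Fin n) → ℝ) (hQ : ∀ g, Q g = ∑ j, q g j)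
    (P : SimpleGraph (Fin n) → ℝ) (hP : ∀ g, P g = α - Q g)
    (c : SimpleGraph (Fin n) → Fin n → ℝ)
    (hc : ∀ g i, c g i = γ₀ + f ((deg g i : ℝ) - k i))
    (Δ : ℝ) (hΔ : Δ = f (-1) - f 0)
    (g : SimpleGraph (Fin n)) (hg : ∀ i, (deg g i : ℝ) = k i)
    (i j : Fin n) (hij : g.Adj i j) :
    q (delLink g i j) i = q g i - ((n : ℝ) / ((n : ℝ) + 1)) * Δ + (1 / ((n : ℝ) + 1)) * Δ ∧
    q (delLink g i j) j = q g j - ((n : ℝ) / ((n : ℝ) + 1)) * Δ + (1 / ((n : ℝ) + 1)) * Δ ∧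
    (∀ l, l ≠ i → l ≠ j →
      q (delLink g i j) l = q g l + (2 / ((n : ℝ) + 1)) * Δ) ∧
    Q (delLink g i j) = Q g - (2 / ((n : ℝ) + 1)) * Δ ∧
    P (delLink g i j) = P g + (2 / ((n : ℝ) + 1)) * Δ ∧
    c (delLink g i j) i = c g i + Δ := by
  have hij' : i ≠ j := hij.ne
  have hn' : (n : ℝ) + 1 ≠ 0 := by positivity
  have hf : ∀ l, f ((deg g l : ℝ) - k l) = f 0 := fun l => by rw [hg, sub_self]
  have hf' : ∀ l, f ((deg (delLink g i j) l : ℝ) - k l)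
      = f 0 + (if l = i then Δ else 0) + (if l = j then Δ else 0) := by
    intro l
    by_cases hi : l = i
    · subst hi
      rw [deg_delLink_left hij, hg, sub_sub_cancel_left, hΔ]
      simp [hij']
    · by_cases hj : l = j
      · subst hj
        rw [deg_delLink_right hij, hg, sub_sub_cancel_left, hΔ]
        simp [hi]
      · rw [deg_delLink_of_ne g hi hj, hf]
        simp [hi, hj]
  have hq' : ∀ l, q (delLink g i j) l = q g l + (2 / ((n : ℝ) + 1)) * Δ
      - (if l = i then Δ else 0) - (if l = j then Δ else 0) := by
    intro l
    rw [hq, hq, sum_erase_eq_sub (mem_univ l), sum_erase_eq_sub (mem_univ l)]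
    simp only [hf, hf', sum_add_distrib, sum_ite_eq', mem_univ, if_true]
    field_simp
    ring
  have hQ' : Q (delLink g i j) = Q g - (2 / ((n : ℝ) + 1)) * Δ := by
    rw [hQ, hQ]
    simp only [hq', sum_add_distrib, sum_sub_distrib, sum_ite_eq', mem_univ, if_true,
      sum_const, card_univ, Fintype.card_fin, nsmul_eq_mul]
    field_simp
    ring
  refine ⟨?_, ?_, fun l hi hj => ?_, hQ', ?_, ?_⟩
  · rw [hq', if_pos rfl, if_neg hij']
    field_simp
    ring
  · rw [hq', if_neg hij'.symm, if_pos rfl]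
    field_simp
    ring
  · rw [hq', if_neg hi, if_neg hj, sub_zero, sub_zero]
  · rw [hP, hP, hQ']
    ring
  · rw [hc, hc, hf', hf, if_pos rfl, if_neg hij']
    ring
end

section
/- Let n ≥ 1, let f : ℝ → ℝ, let k_1,…,k_n be reals, and write Δ⁺ = f(1) − f(0). Let g be a graph on {1,…,n} with η_i(g) = k_i for all i, and let ij be a pair of distinct vertices with ij ∉ g. Then the change in firm i's profit from adding the link ij satisfies the exact identity Y_i(g + ij) − Y_i(g) = −Δ⁺ · ((n−1)/(n+1)) · (2·q_i(g) − ((n−1)/(n+1))·Δ⁺). -/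
open Finset

/-- At the Cournot quantities for marginal costs `γ₀ + a i`, the markup of each firm over its cost
equals its quantity. -/
theorem cournot_markup_eq_quantity {n : ℕ} (α γ₀ : ℝ) (a q : Fin n → ℝ)
    (hq : ∀ i, q i = (α - γ₀ - n * a i + ∑ j ∈ univ.erase i, a j) / (n + 1)) (i : Fin n) :
    α - ∑ j, q j - (γ₀ + a i) = q i := by
  have hn : (n : ℝ) + 1 ≠ 0 := by positivity
  have hq' : ∀ l, q l = (α - γ₀ + ∑ j, a j) / (n + 1) - a l := by
    intro l
    rw [hq, ← add_sum_erase univ a (mem_univ l)]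
    field_simp
    ring
  have hsum : ∑ j, q j = n * ((α - γ₀ + ∑ j, a j) / (n + 1)) - ∑ j, a j := by
    simp [hq', sum_sub_distrib]
  rw [hsum, hq']
  field_simp
  ring

theorem addLink_comm {n : ℕ} (g : SimpleGraph (Fin n)) (i j : Fin n) :
    addLink g i j = addLink g j i := by
  rw [addLink, addLink, Sym2.eq_swap]

theorem deg_addLink_left {n : ℕ} (g : SimpleGraph (Fin n)) {i j : Fin n} (hij : i ≠ j)
    (hnadj : ¬ g.Adj i j) : deg (addLink g i j) i = deg g i + 1 := by
  have h : (addLink g i j).neighborSet i = insert j (g.neighborSet i) := by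
    ext l
    simp only [addLink, SimpleGraph.mem_neighborSet, SimpleGraph.sup_adj,
      SimpleGraph.fromEdgeSet_adj, Set.mem_singleton_iff, Set.mem_insert_iff, Sym2.eq_iff]
    grind
  rw [deg, deg, h, Nat.card_coe_set_eq, Nat.card_coe_set_eq,
    Set.ncard_insert_of_notMem (by simpa using hnadj)]

theorem deg_addLink_right {n : ℕ} (g : SimpleGraph (Fin n)) {i j : Fin n} (hij : i ≠ j)
    (hnadj : ¬ g.Adj i j) : deg (addLink g i j) j = deg g j + 1 := by
  rw [addLink_comm]
  exact deg_addLink_left g hij.symm fun h => hnadj h.symm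

theorem deg_addLink_of_ne {n : ℕ} (g : SimpleGraph (Fin n)) {i j l : Fin n} (hi : l ≠ i)
    (hj : l ≠ j) : deg (addLink g i j) l = deg g l := by
  have h : (addLink g i j).neighborSet l = g.neighborSet l := by
    ext m
    simp only [addLink, SimpleGraph.mem_neighborSet, SimpleGraph.sup_adj,
      SimpleGraph.fromEdgeSet_adj, Set.mem_singleton_iff, Sym2.eq_iff]
    grind
  rw [deg, deg, h]

theorem stmt_10 (n : ℕ) (hn : 1 ≤ n) (α γ₀ : ℝ) (f : ℝ → ℝ) (k : Fin n → ℝ)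
    (q : SimpleGraph (Fin n) → Fin n → ℝ)
    (hq : ∀ g i, q g i = (α - γ₀ - n * f ((deg g i : ℝ) - k i)
      + ∑ j ∈ univ.erase i, f ((deg g j : ℝ) - k j)) / (n + 1))
    (P : SimpleGraph (Fin n) → ℝ) (hP : ∀ g, P g = α - ∑ j, q g j)
    (c : SimpleGraph (Fin n) → Fin n → ℝ)
    (hc : ∀ g i, c g i = γ₀ + f ((deg g i : ℝ) - k i))
    (Y : Fin n → SimpleGraph (Fin n) → ℝ)
    (hY : ∀ i g, Y i g = q g i * (P g - c g i))
    (Δ : ℝ) (hΔ : Δ = f 1 - f 0)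
    (g : SimpleGraph (Fin n)) (hg : ∀ i, (deg g i : ℝ) = k i)
    (i j : Fin n) (hij : i ≠ j) (hnadj : ¬ g.Adj i j) :
    Y i (addLink g i j) - Y i g =
      -Δ * (((n : ℝ) - 1) / ((n : ℝ) + 1)) *
        (2 * q g i - (((n : ℝ) - 1) / ((n : ℝ) + 1)) * Δ) := by
  have hYq : ∀ h, Y i h = q h i ^ 2 := by
    intro h
    rw [hY, hP, hc, cournot_markup_eq_quantity α γ₀
      (fun l => f ((deg h l : ℝ) - k l)) (q h) (hq h) i]
    ring
  have hother : ∑ l ∈ univ.erase i, f ((deg (addLink g i j) l : ℝ) - k l)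
      = ∑ l ∈ univ.erase i, f ((deg g l : ℝ) - k l) + Δ := by
    have hj : j ∈ univ.erase i := by simp [hij.symm]
    rw [← add_sum_erase _ _ hj, ← add_sum_erase _ (fun l => f ((deg g l : ℝ) - k l)) hj,
      sum_congr rfl (g := fun l => f ((deg g l : ℝ) - k l)) fun l hl => by
        rw [deg_addLink_of_ne g (by grind) (by grind)],
      deg_addLink_right g hij hnadj, hΔ]
    push_cast
    rw [hg j, add_sub_cancel_left, sub_self]
    ring
  have hown : f ((deg (addLink g i j) i : ℝ) - k i) = f ((deg g i : ℝ) - k i) + Δ := by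
    rw [deg_addLink_left g hij hnadj, hΔ]
    push_cast
    rw [hg i, add_sub_cancel_left, sub_self]
    ring
  have hquant : q (addLink g i j) i = q g i - ((n : ℝ) - 1) / ((n : ℝ) + 1) * Δ := by
    rw [hq, hq g, hother, hown]
    ring
  rw [hYq, hYq, hquant]
  ring
end
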